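/- Let 0.6 ≤ σ ≤ 2/3 and let X and X₀ be real numbers with X ≥ X₀ ≥ 433. Then Σ_{n ≥ X} d(n)²/n^{2σ} ≤ C(σ,X₀) · X^{1−2σ} · (log X)³, where the sum runs over all integers n ≥ X. -/

import Mathlib

open Real

/-- The constant `C(σ, X₀)`. -/
noncomputable def Cconst (σ X₀ : ℝ) : ℝ :=
  σ / (2 * (2*σ - 1)^4) *
    ((2*σ - 1)^3 + 3*(2*σ - 1)^2 / Real.log X₀ + 6*(2*σ - 1) / (Real.log X₀)^2
      + 6 / (Real.log X₀)^3)

/-- `d n` is the number of positive divisors of `n`. -/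
def numDiv (n : ℕ) : ℕ := n.divisors.card

/-! ### The Dirichlet convolution identity for `d²` -/

section Convolution

open ArithmeticFunction

theorem mul_zeta_apply_prime_pow {R : Type*} [Semiring R] (f : ArithmeticFunction R) {p : ℕ}
    (hp : p.Prime) (k : ℕ) :
    (f * (zeta : ArithmeticFunction R)) (p ^ k) = ∑ i ∈ Finset.range (k + 1), f (p ^ i) := by
  rw [coe_mul_zeta_apply, Nat.sum_divisors_prime_pow hp]

/-- The indicator function of squarefree numbers. -/
noncomputable def squarefreeInd : ArithmeticFunction ℝ :=
  pmul (moebius : ArithmeticFunction ℝ) (moebius : ArithmeticFunction ℝ)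

theorem squarefreeInd_apply (n : ℕ) : squarefreeInd n = if Squarefree n then 1 else 0 := by
  have h : ((moebius n ^ 2 : ℤ) : ℝ) = ((if Squarefree n then 1 else 0 : ℤ) : ℝ) := by
    rw [moebius_sq]
  simp only [squarefreeInd, pmul_apply, intCoe_apply]
  push_cast at h
  rw [← sq, h]

theorem isMultiplicative_squarefreeInd : squarefreeInd.IsMultiplicative :=
  isMultiplicative_moebius.intCast.pmul isMultiplicative_moebius.intCast

theorem squarefreeInd_apply_prime_pow {p : ℕ} (hp : p.Prime) (k : ℕ) :
    squarefreeInd (p ^ k) = if k ≤ 1 then 1 else 0 := by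
  simp only [squarefreeInd, pmul_apply, intCoe_apply]
  rcases Nat.eq_zero_or_pos k with rfl | hk
  · simp
  · rw [moebius_apply_prime_pow hp hk.ne']
    by_cases h : k = 1
    · simp [h]
    · simp [h, show ¬ k ≤ 1 by omega]

/-- `d² = |μ| * 1 * 1 * 1` as a Dirichlet convolution. -/
theorem sigma_zero_sq_eq :
    pmul (sigma 0 : ArithmeticFunction ℝ) (sigma 0 : ArithmeticFunction ℝ)
      = squarefreeInd * (zeta : ArithmeticFunction ℝ) * (zeta : ArithmeticFunction ℝ)
        * (zeta : ArithmeticFunction ℝ) := by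
  have hζ : (zeta : ArithmeticFunction ℝ).IsMultiplicative := isMultiplicative_zeta.natCast
  have hσ : (sigma 0 : ArithmeticFunction ℝ).IsMultiplicative := isMultiplicative_sigma.natCast
  refine ((hσ.pmul hσ).eq_iff_eq_on_prime_powers _ _
    (((isMultiplicative_squarefreeInd.mul hζ).mul hζ).mul hζ)).2 fun p k hp => ?_
  have h0 : squarefreeInd 1 = 1 := isMultiplicative_squarefreeInd.map_one
  have h1 (k : ℕ) : (squarefreeInd * (zeta : ArithmeticFunction ℝ)) (p ^ k)
      = if k = 0 then 1 else 2 := by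
    rw [mul_zeta_apply_prime_pow _ hp]
    induction k with
    | zero => simp [h0]
    | succ k ih =>
      rw [Finset.sum_range_succ, ih, squarefreeInd_apply_prime_pow hp]
      rcases Nat.eq_zero_or_pos k with rfl | hk
      · norm_num
      · simp [hk.ne']
  have h2 (k : ℕ) : (squarefreeInd * (zeta : ArithmeticFunction ℝ)
      * (zeta : ArithmeticFunction ℝ)) (p ^ k) = 2 * k + 1 := by
    rw [mul_zeta_apply_prime_pow _ hp]
    induction k with
    | zero => simp [h0]
    | succ k ih =>
      rw [Finset.sum_range_succ, ih, h1]
      simp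
      ring
  rw [mul_zeta_apply_prime_pow _ hp, pmul_apply, natCoe_apply, sigma_zero_apply_prime_pow hp]
  induction k with
  | zero => simp [h0]
  | succ k ih =>
    rw [Finset.sum_range_succ, ← ih, h2]
    push_cast
    ring

/-- The arithmetic function `n ↦ 1 / n`. -/
noncomputable def invFn : ArithmeticFunction ℝ := ⟨fun n => (n : ℝ)⁻¹, by simp⟩

theorem invFn_apply (n : ℕ) : invFn n = (n : ℝ)⁻¹ := rfl

theorem invFn_pmul_mul (f g : ArithmeticFunction ℝ) :
    pmul invFn (f * g) = pmul invFn f * pmul invFn g := by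
  ext n
  simp only [pmul_apply, mul_apply, Finset.mul_sum, invFn_apply]
  refine Finset.sum_congr rfl fun x hx => ?_
  rw [← (Nat.mem_divisorsAntidiagonal.1 hx).1]
  push_cast
  rw [mul_inv]
  ring

/-- The summatory function of `d²`. -/
def divSqSum (n : ℕ) : ℕ := ∑ m ∈ Finset.Ioc 0 n, numDiv m ^ 2

/-- `∑_{c ≤ n} |μ(c)| / c`. -/
noncomputable def squarefreeHarm (n : ℕ) : ℝ :=
  ∑ c ∈ Finset.Ioc 0 n, (c : ℝ)⁻¹ * squarefreeInd c

theorem divSqSum_le_mul_sum (N : ℕ) :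
    (divSqSum N : ℝ) ≤ N * ∑ a ∈ Finset.Ioc 0 N, (a : ℝ)⁻¹ *
      ∑ b ∈ Finset.Ioc 0 (N / a), (b : ℝ)⁻¹ * squarefreeHarm (N / a / b) := by
  set ζ' : ArithmeticFunction ℝ := (zeta : ArithmeticFunction ℝ)
  set g : ArithmeticFunction ℝ := squarefreeInd * ζ' * ζ'
  have hg0 (n : ℕ) : 0 ≤ g n := by
    simp only [g, ζ', coe_mul_zeta_apply]
    exact Finset.sum_nonneg fun i _ => Finset.sum_nonneg fun j _ => by
      rw [squarefreeInd_apply]; split_ifs <;> norm_num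
  have h1 : (divSqSum N : ℝ) = ∑ n ∈ Finset.Ioc 0 N, (g * ζ') n := by
    rw [← sigma_zero_sq_eq, divSqSum]
    push_cast
    refine Finset.sum_congr rfl fun n _ => ?_
    rw [pmul_apply, natCoe_apply, sigma_zero_apply, numDiv, sq]
  have hz : pmul invFn ζ' = invFn := pmul_zeta _
  have h2 : pmul invFn g = invFn * (invFn * pmul invFn squarefreeInd) := by
    simp only [g]
    rw [invFn_pmul_mul, invFn_pmul_mul, hz]
    ring
  have h3 : ∑ a ∈ Finset.Ioc 0 N, (a : ℝ)⁻¹ *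
      ∑ b ∈ Finset.Ioc 0 (N / a), (b : ℝ)⁻¹ * squarefreeHarm (N / a / b)
      = ∑ n ∈ Finset.Ioc 0 N, pmul invFn g n := by
    rw [h2, sum_Ioc_mul_eq_sum_sum]
    refine Finset.sum_congr rfl fun a _ => ?_
    rw [sum_Ioc_mul_eq_sum_sum, invFn_apply]
    rfl
  rw [h1, sum_Ioc_mul_zeta_eq_sum, h3, Finset.mul_sum]
  refine Finset.sum_le_sum fun n _ => ?_
  calc g n * ((N / n : ℕ) : ℝ) ≤ g n * ((N : ℝ) / n) :=
        mul_le_mul_of_nonneg_left Nat.cast_div_le (hg0 n)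
    _ = N * pmul invFn g n := by rw [pmul_apply, invFn_apply]; ring

end Convolution

/-! ### Explicit bounds for logarithmically weighted harmonic sums -/

theorem two_div_le_log_succ_sub_log {n : ℕ} (hn : 0 < n) :
    2 / (2 * (n : ℝ) + 1) ≤ log ((n + 1 : ℕ) : ℝ) - log n := by
  have hn' : (0 : ℝ) < n := Nat.cast_pos.2 hn
  rw [← log_div (by positivity) hn'.ne']
  have h := le_log_one_add_of_nonneg (x := 1 / (n : ℝ)) (by positivity)
  convert h using 1
  · field_simp
    ring
  · congr 1
    push_cast
    field_simp

theorem sum_inv_le_log {n : ℕ} (hn : 0 < n) :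
    ∑ b ∈ Finset.Ioc 0 n, (b : ℝ)⁻¹ ≤ log n + 0.585 + 0.45 / n := by
  have h2 := log_two_gt_d9
  have h3 := log_three_gt_d9
  have h5 := log_five_gt_d9
  rcases lt_or_ge n 5 with h | h
  · interval_cases n
    · norm_num [Finset.sum_Ioc_succ_top]
    · norm_num [Finset.sum_Ioc_succ_top] at *
      linarith
    · norm_num [Finset.sum_Ioc_succ_top] at *
      linarith
    · norm_num [Finset.sum_Ioc_succ_top, log_four_eq] at *
      linarith
  · induction n, h using Nat.le_induction with
    | base =>
      norm_num [Finset.sum_Ioc_succ_top] at *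
      linarith
    | succ m hm ih =>
      rw [Finset.sum_Ioc_succ_top (Nat.zero_le m)]
      have hm' : (5 : ℝ) ≤ m := by exact_mod_cast hm
      have h := two_div_le_log_succ_sub_log (n := m) (by omega)
      have key : ((m + 1 : ℕ) : ℝ)⁻¹ + 0.45 / m
          ≤ 2 / (2 * (m : ℝ) + 1) + 0.45 / ((m + 1 : ℕ) : ℝ) := by
        push_cast
        rw [inv_eq_one_div, div_add_div _ _ (by positivity) (by positivity),
          div_add_div _ _ (by positivity) (by positivity),
          div_le_div_iff₀ (by positivity) (by positivity)]
        nlinarith [mul_nonneg (sub_nonneg.2 hm') (sub_nonneg.2 hm'),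
          pow_pos (by linarith : (0:ℝ) < m) 3,
          mul_nonneg (mul_nonneg (sub_nonneg.2 hm') (by linarith : (0:ℝ) ≤ m))
            (by linarith : (0:ℝ) ≤ m)]
      linarith [ih (by omega)]

/-- `∑_{b ≤ y} log(y / b) ^ k / b`. -/
noncomputable def logPowSum (k : ℕ) (y : ℝ) : ℝ :=
  ∑ b ∈ Finset.Ioc 0 ⌊y⌋₊, (b : ℝ)⁻¹ * log (y / b) ^ k

theorem log_add_div_mono {s t : ℝ} (hs : 1 ≤ s) (hst : s ≤ t) :
    log s + 0.45 / s ≤ log t + 0.45 / t := by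
  have hs0 : 0 < s := by linarith
  have ht0 : 0 < t := by linarith
  have h := one_sub_inv_le_log_of_pos (div_pos ht0 hs0)
  rw [log_div ht0.ne' hs0.ne', inv_div] at h
  have : 0.45 / s - 0.45 / t ≤ 1 - s / t := by
    rw [div_sub_div _ _ hs0.ne' ht0.ne', one_sub_div ht0.ne',
      div_le_div_iff₀ (by positivity) ht0]
    nlinarith [mul_nonneg (mul_nonneg (sub_nonneg.2 hst) ht0.le) (sub_nonneg.2 hs)]
  linarith

theorem logPowSum_zero_le {y : ℝ} (hy : 1 ≤ y) :
    logPowSum 0 y ≤ log y + 0.585 + 0.45 / y := by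
  have hn : 0 < ⌊y⌋₊ := Nat.floor_pos.2 hy
  have h := sum_inv_le_log hn
  have h' := log_add_div_mono (s := ⌊y⌋₊) (t := y) (by exact_mod_cast hn)
    (Nat.floor_le (by linarith))
  simp only [logPowSum, pow_zero, mul_one]
  linarith

/-- A pointwise bound for `logPowSum k` integrates to a bound for `logPowSum (k + 1)`. -/
theorem logPowSum_succ_le {k : ℕ} {F G : ℝ → ℝ}
    (hF : ∀ y, 1 ≤ y → (k + 1) * logPowSum k y / y ≤ F y)
    (hG : ∀ y, 1 ≤ y → HasDerivAt G (F y) y) (hG1 : 0 ≤ G 1) {y : ℝ} (hy : 1 ≤ y) :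
    logPowSum (k + 1) y ≤ G y := by
  set N := ⌊y⌋₊
  set f : ℝ → ℝ := fun t => ∑ b ∈ Finset.Ioc 0 N, (b : ℝ)⁻¹ * (max (log (t / b)) 0) ^ (k + 1)
  have hmax {t : ℝ} (ht : 1 ≤ t) {b : ℕ} (hb : 0 < b) :
      max (log (t / b)) 0 = if b ≤ ⌊t⌋₊ then log (t / b) else 0 := by
    have hb' : (0 : ℝ) < b := Nat.cast_pos.2 hb
    split_ifs with h
    · exact max_eq_left (log_nonneg ((one_le_div hb').2 ((Nat.le_floor_iff (by linarith)).1 h)))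
    · have : t < b := (Nat.floor_lt (by linarith)).1 (not_le.1 h)
      exact max_eq_right (log_nonpos (by positivity) ((div_le_one hb').2 this.le))
  have hf {t : ℝ} (ht : 1 ≤ t) (hty : t ≤ y) (j : ℕ) :
      ∑ b ∈ Finset.Ioc 0 N, (b : ℝ)⁻¹ * (if b ≤ ⌊t⌋₊ then log (t / b) ^ j else 0)
        = logPowSum j t := by
    rw [logPowSum]
    simp only [mul_ite, mul_zero]
    rw [← Finset.sum_filter]
    congr 1
    ext b
    have := Nat.floor_mono hty
    simp only [Finset.mem_filter, Finset.mem_Ioc, N]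
    omega
  have hfeq {t : ℝ} (ht : 1 ≤ t) (hty : t ≤ y) : f t = logPowSum (k + 1) t := by
    rw [← hf ht hty]
    refine Finset.sum_congr rfl fun b hb => ?_
    rw [hmax ht (Finset.mem_Ioc.1 hb).1, ite_pow, zero_pow (Nat.succ_ne_zero k)]
  rw [← hfeq hy le_rfl]
  refine image_le_of_deriv_right_le_deriv_boundary (a := 1) (b := y) (f := f)
    (f' := fun t => (k + 1) * logPowSum k t / t) (B := G) (B' := F) ?_ ?_ ?_ ?_ ?_ ?_
    (Set.right_mem_Icc.2 hy)
  · refine continuousOn_finsetSum _ fun b hb => ?_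
    have hb' : (0 : ℝ) < b := Nat.cast_pos.2 (Finset.mem_Ioc.1 hb).1
    refine continuousOn_const.mul (ContinuousOn.pow (ContinuousOn.sup ?_ continuousOn_const) _)
    refine ContinuousOn.log (continuousOn_id.div_const _) fun t ht => ?_
    have : 0 < t := by linarith [ht.1]
    exact (div_pos this hb').ne'
  · intro t ht
    have ht0 : 0 < t := by linarith [ht.1]
    have hsum : (k + 1) * logPowSum k t / t = ∑ b ∈ Finset.Ioc 0 N,
        (b : ℝ)⁻¹ * (if b ≤ ⌊t⌋₊ then (k + 1) * log (t / b) ^ k / t else 0) := by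
      rw [← hf ht.1 ht.2.le, Finset.mul_sum, Finset.sum_div]
      refine Finset.sum_congr rfl fun b _ => ?_
      split_ifs <;> ring
    rw [hsum]
    refine HasDerivWithinAt.fun_sum fun b hb => HasDerivWithinAt.const_mul _ ?_
    have hb0 := (Finset.mem_Ioc.1 hb).1
    have hb' : (0 : ℝ) < b := Nat.cast_pos.2 hb0
    split_ifs with h
    · have hd : HasDerivAt (fun s : ℝ => log (s / b) ^ (k + 1))
          ((k + 1) * log (t / b) ^ k / t) t := by
        have h1 : HasDerivAt (fun s : ℝ => log (s / b)) (1 / t) t := by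
          refine (((hasDerivAt_id' t).div_const (b : ℝ)).log (by positivity)).congr_deriv ?_
          rw [div_div_div_cancel_right₀ hb'.ne']
        refine (h1.fun_pow (k + 1)).congr_deriv ?_
        rw [Nat.add_sub_cancel]
        push_cast
        ring
      refine hd.hasDerivWithinAt.congr (fun s hs => ?_) ?_
      · rw [hmax (ht.1.trans hs) hb0, if_pos (h.trans (Nat.floor_mono hs))]
      · rw [hmax ht.1 hb0, if_pos h]
    · have hlt : t < b := (Nat.floor_lt ht0.le).1 (not_le.1 h)
      refine ((hasDerivAt_const t (0 : ℝ)).congr_of_eventuallyEq ?_).hasDerivWithinAt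
      filter_upwards [Ioo_mem_nhds ht0 hlt] with s hs
      have hs0 : 0 < s := hs.1
      rw [max_eq_right (log_nonpos (by positivity) ((div_le_one hb').2 hs.2.le)),
        zero_pow (Nat.succ_ne_zero k)]
  · rw [hfeq le_rfl hy]
    simpa [logPowSum] using hG1
  · exact fun t ht => (hG t ht.1).continuousAt.continuousWithinAt
  · exact fun t ht => (hG t ht.1).hasDerivWithinAt
  · exact fun t ht => hF t ht.1

theorem logPowSum_one_le {y : ℝ} (hy : 1 ≤ y) :
    logPowSum 1 y ≤ log y ^ 2 / 2 + 0.585 * log y + 0.45 * (1 - 1 / y) := by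
  refine logPowSum_succ_le (k := 0) (F := fun y => (log y + 0.585 + 0.45 / y) / y)
    (G := fun y => log y ^ 2 / 2 + 0.585 * log y + 0.45 * (1 - 1 / y)) ?_ ?_ (by norm_num) hy
  · intro t ht
    have := logPowSum_zero_le ht
    have ht0 : 0 < t := by linarith
    simp only [Nat.cast_zero, zero_add, one_mul]
    gcongr
  · intro t ht
    have ht0 : 0 < t := by linarith
    have h := hasDerivAt_log ht0.ne'
    simp only [one_div]
    refine ((((h.fun_pow 2).div_const 2).fun_add (h.const_mul 0.585)).fun_add
      (((hasDerivAt_inv ht0.ne').const_sub 1).const_mul 0.45)).congr_deriv ?_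
    norm_num
    field_simp

theorem logPowSum_two_le {y : ℝ} (hy : 1 ≤ y) :
    logPowSum 2 y ≤ log y ^ 3 / 3 + 0.585 * log y ^ 2 + 0.9 * log y := by
  have h : logPowSum 2 y ≤ log y ^ 3 / 3 + 0.585 * log y ^ 2 + 0.9 * (log y - (1 - 1 / y)) := by
    refine logPowSum_succ_le (k := 1)
      (F := fun y => 2 * (log y ^ 2 / 2 + 0.585 * log y + 0.45 * (1 - 1 / y)) / y)
      (G := fun y => log y ^ 3 / 3 + 0.585 * log y ^ 2 + 0.9 * (log y - (1 - 1 / y))) ?_ ?_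
      (by norm_num) hy
    · intro t ht
      have := logPowSum_one_le ht
      have ht0 : 0 < t := by linarith
      simp only [Nat.cast_one, one_add_one_eq_two]
      gcongr
    · intro t ht
      have ht0 : 0 < t := by linarith
      have h := hasDerivAt_log ht0.ne'
      simp only [one_div]
      refine ((((h.fun_pow 3).div_const 3).fun_add ((h.fun_pow 2).const_mul 0.585)).fun_add
        ((h.fun_sub ((hasDerivAt_inv ht0.ne').const_sub 1)).const_mul 0.9)).congr_deriv ?_
      norm_num
      field_simp
      ring
  have : 1 / y ≤ 1 := (div_le_one (by linarith)).2 hy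
  linarith

/-- The number of `k ≤ n` divisible neither by `4` nor by `9`. -/
def sievedCount (n : ℕ) : ℕ :=
  ((Finset.Ioc 0 n).filter fun k => ¬ 4 ∣ k ∧ ¬ 9 ∣ k).card

theorem sievedCount_succ (n : ℕ) :
    sievedCount (n + 1) = sievedCount n + if ¬ 4 ∣ n + 1 ∧ ¬ 9 ∣ n + 1 then 1 else 0 := by
  rw [sievedCount, sievedCount, ← Finset.insert_Ioc_right_eq_Ioc_add_one (Nat.zero_le n),
    Finset.filter_insert]
  split_ifs <;> simp

theorem sievedCount_add_period (n : ℕ) : sievedCount (n + 36) = sievedCount n + 24 := by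
  have hper : Function.Periodic (fun k => ¬ 4 ∣ k ∧ ¬ 9 ∣ k) 36 := fun k => by
    simp only [eq_iff_iff]
    omega
  have h := Nat.filter_Ico_card_eq_of_periodic (n + 1) 36 (fun k => ¬ 4 ∣ k ∧ ¬ 9 ∣ k) hper
  rw [show Nat.count (fun k => ¬ 4 ∣ k ∧ ¬ 9 ∣ k) 36 = 24 by decide +kernel] at h
  rw [← h, sievedCount, sievedCount, ← Finset.card_union_of_disjoint, ← Finset.filter_union]
  · congr 2
    ext k
    simp only [Finset.mem_Ioc, Finset.mem_union, Finset.mem_Ico]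
    omega
  · refine Finset.disjoint_filter_filter (Finset.disjoint_left.2 fun k hk hk' => ?_)
    simp only [Finset.mem_Ioc, Finset.mem_Ico] at hk hk'
    omega

theorem three_mul_sievedCount_le (n : ℕ) : 3 * sievedCount n ≤ 2 * n + 4 := by
  induction n using Nat.strong_induction_on with
  | _ n ih =>
    rcases lt_or_ge n 36 with h | h
    · clear ih
      revert n
      decide +kernel
    · obtain ⟨m, rfl⟩ := Nat.exists_eq_add_of_le' h
      have := ih m (by omega)
      rw [sievedCount_add_period]
      omega

/-- `∑ 1 / k` over the `k ≤ n` divisible neither by `4` nor by `9`. -/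
noncomputable def sievedHarm (n : ℕ) : ℝ :=
  ∑ k ∈ Finset.Ioc 0 n, (k : ℝ)⁻¹ * if ¬ 4 ∣ k ∧ ¬ 9 ∣ k then 1 else 0

theorem squarefreeHarm_le_sievedHarm (n : ℕ) : squarefreeHarm n ≤ sievedHarm n := by
  refine Finset.sum_le_sum fun k _ => mul_le_mul_of_nonneg_left ?_ (by positivity)
  rw [squarefreeInd_apply]
  split_ifs with h1 h2 h2
  · exact le_rfl
  · refine absurd ⟨fun h => ?_, fun h => ?_⟩ h2
    · exact absurd (h1 2 h) (by decide)
    · exact absurd (h1 3 h) (by decide)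
  · exact zero_le_one
  · exact le_rfl

theorem sievedHarm_sub_le {n : ℕ} (hn : 8 ≤ n) :
    sievedHarm n - sievedCount n / n ≤ 2 / 3 * log n + (1.101 - 2 / 3) - 4 / 3 / n := by
  induction n, hn using Nat.le_induction with
  | base =>
    have h2 := log_two_gt_d9
    have h8 : log 8 = 3 * log 2 := by
      rw [show (8 : ℝ) = 2 ^ 3 by norm_num, log_pow]; norm_num
    rw [show sievedCount 8 = 6 by decide]
    norm_num [sievedHarm, Finset.sum_Ioc_succ_top, h8]
    norm_num at h2
    linarith
  | succ n hn ih =>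
    have hn0 : (0 : ℝ) < n := by positivity
    have hS : (3 * sievedCount n : ℝ) ≤ 2 * n + 4 := by exact_mod_cast three_mul_sievedCount_le n
    have hlog := two_div_le_log_succ_sub_log (n := n) (by omega)
    have hstep : sievedHarm (n + 1) - sievedCount (n + 1) / ((n + 1 : ℕ) : ℝ)
        = sievedHarm n - sievedCount n / n + sievedCount n * (1 / (n * (n + 1))) := by
      rw [sievedHarm, Finset.sum_Ioc_succ_top (Nat.zero_le n), ← sievedHarm, sievedCount_succ]
      push_cast
      field_simp
      ring
    have h1 : (sievedCount n : ℝ) * (1 / (n * (n + 1)))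
        ≤ ((2 * n + 4) / 3) * (1 / (n * (n + 1))) := by
      gcongr
      linarith
    have h2 : ((2 * n + 4) / 3) * (1 / ((n : ℝ) * (n + 1)))
        = 2 / 3 * (1 / (n + 1)) + (4 / 3 / n - 4 / 3 / (n + 1)) := by
      field_simp
      ring
    have h3 : 1 / ((n : ℝ) + 1) ≤ 2 / (2 * n + 1) := by
      rw [div_le_div_iff₀ (by positivity) (by positivity)]
      linarith
    rw [hstep]
    push_cast at *
    linarith

theorem squarefreeHarm_le {n : ℕ} (hn : 0 < n) :
    squarefreeHarm n ≤ 2 / 3 * log n + 1.101 := by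
  refine (squarefreeHarm_le_sievedHarm n).trans ?_
  rcases lt_or_ge n 8 with h | h
  · have h2 := log_two_gt_d9
    have h3 := log_three_gt_d9
    have h5 := log_five_gt_d9
    have h6 : log 6 = log 2 + log 3 := by
      rw [← log_mul (by norm_num) (by norm_num)]; norm_num
    have h7 := two_div_le_log_succ_sub_log (n := 6) (by norm_num)
    norm_num [h6] at h2 h3 h5 h7
    interval_cases n <;>
      norm_num [sievedHarm, Finset.sum_Ioc_succ_top, log_four_eq, h6] <;> linarith
  · have h1 := sievedHarm_sub_le h
    have hS : (3 * sievedCount n : ℝ) ≤ 2 * n + 4 := by exact_mod_cast three_mul_sievedCount_le n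
    have h2 : (sievedCount n : ℝ) / n ≤ 2 / 3 + 4 / 3 / n := by
      have : (0 : ℝ) < n := by positivity
      rw [div_le_iff₀ this]
      field_simp
      linarith
    linarith

theorem sum_inv_mul_squarefreeHarm_le {y : ℝ} (hy : 1 ≤ y) :
    ∑ b ∈ Finset.Ioc 0 ⌊y⌋₊, (b : ℝ)⁻¹ * squarefreeHarm (⌊y⌋₊ / b)
      ≤ log y ^ 2 / 3 + 1.491 * log y + 0.944085 + 0.19545 / y := by
  have h : ∑ b ∈ Finset.Ioc 0 ⌊y⌋₊, (b : ℝ)⁻¹ * squarefreeHarm (⌊y⌋₊ / b)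
      ≤ 2 / 3 * logPowSum 1 y + 1.101 * logPowSum 0 y := by
    simp only [logPowSum, Finset.mul_sum, ← Finset.sum_add_distrib]
    refine Finset.sum_le_sum fun b hb => ?_
    obtain ⟨hb0, hb⟩ := Finset.mem_Ioc.1 hb
    have hb' : (0 : ℝ) < b := Nat.cast_pos.2 hb0
    have hpos : 0 < ⌊y⌋₊ / b := Nat.div_pos hb hb0
    have hle : ((⌊y⌋₊ / b : ℕ) : ℝ) ≤ y / b :=
      Nat.cast_div_le.trans (by gcongr; exact Nat.floor_le (by linarith))
    have hlog := log_le_log (Nat.cast_pos.2 hpos) hle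
    have := squarefreeHarm_le hpos
    calc (b : ℝ)⁻¹ * squarefreeHarm (⌊y⌋₊ / b)
        ≤ (b : ℝ)⁻¹ * (2 / 3 * log (y / b) + 1.101) := by gcongr; linarith
      _ = _ := by ring
  have h0 := logPowSum_zero_le hy
  have h1 := logPowSum_one_le hy
  have e1 : 0.45 / y = 0.45 * (1 / y) := by ring
  have e2 : 0.19545 / y = 0.19545 * (1 / y) := by ring
  rw [e1] at h0
  rw [e2]
  linarith

theorem divSqSum_le_mul_log_poly {N : ℕ} (hN : 1 ≤ N) :
    (divSqSum N : ℝ) ≤ N * (log N ^ 3 / 9 + 0.9405 * log N ^ 2 + 2.11632 * log N + 1.844) := by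
  have hN' : (1 : ℝ) ≤ N := by exact_mod_cast hN
  refine (divSqSum_le_mul_sum N).trans (mul_le_mul_of_nonneg_left ?_ (by positivity))
  have h : ∑ a ∈ Finset.Ioc 0 N, (a : ℝ)⁻¹ *
      ∑ b ∈ Finset.Ioc 0 (N / a), (b : ℝ)⁻¹ * squarefreeHarm (N / a / b)
      ≤ ∑ a ∈ Finset.Ioc 0 N, ((a : ℝ)⁻¹ * log (N / a) ^ 2 / 3
        + 1.491 * ((a : ℝ)⁻¹ * log (N / a) ^ 1) + 0.944085 * ((a : ℝ)⁻¹ * log (N / a) ^ 0)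
        + 0.19545 / N) := by
    refine Finset.sum_le_sum fun a ha => ?_
    obtain ⟨ha0, ha⟩ := Finset.mem_Ioc.1 ha
    have ha' : (0 : ℝ) < a := Nat.cast_pos.2 ha0
    have hy : 1 ≤ (N : ℝ) / a := (one_le_div ha').2 (by exact_mod_cast ha)
    have := sum_inv_mul_squarefreeHarm_le hy
    rw [Nat.floor_div_eq_div] at this
    calc _ ≤ (a : ℝ)⁻¹ * (log (N / a) ^ 2 / 3 + 1.491 * log (N / a) + 0.944085
          + 0.19545 / (N / a)) := by gcongr
      _ = _ := by field_simp
  have hsum : ∑ a ∈ Finset.Ioc 0 N, ((a : ℝ)⁻¹ * log (N / a) ^ 2 / 3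
        + 1.491 * ((a : ℝ)⁻¹ * log (N / a) ^ 1) + 0.944085 * ((a : ℝ)⁻¹ * log (N / a) ^ 0)
        + 0.19545 / N)
      = logPowSum 2 N / 3 + 1.491 * logPowSum 1 N + 0.944085 * logPowSum 0 N + 0.19545 := by
    simp only [Finset.sum_add_distrib, ← Finset.mul_sum, ← Finset.sum_div, logPowSum,
      Nat.floor_natCast, Finset.sum_const, Nat.card_Ioc, nsmul_eq_mul, Nat.sub_zero]
    field_simp
  rw [hsum] at h
  have h0 := logPowSum_zero_le hN'
  have h1 := logPowSum_one_le hN'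
  have h2 := logPowSum_two_le hN'
  have hinv : 1 / (N : ℝ) ≤ 1 := (div_le_one (by linarith)).2 hN'
  have hinv0 : 0 ≤ 1 / (N : ℝ) := by positivity
  have e1 : 0.45 / (N : ℝ) = 0.45 * (1 / N) := by ring
  rw [e1] at h0
  linarith

theorem divSqSum_le_of_large {N : ℕ} (hN : 6400 ≤ N) :
    (divSqSum N : ℝ) ≤ N * log N ^ 3 / 4 := by
  refine (divSqSum_le_mul_log_poly (by omega)).trans ?_
  rw [mul_div_assoc]
  refine mul_le_mul_of_nonneg_left ?_ (by positivity)
  have hL : 8.76 ≤ log N := by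
    have h : log 6400 ≤ log N := log_le_log (by norm_num) (by exact_mod_cast hN)
    have h' : log 6400 = 8 * log 2 + 2 * log 5 := by
      rw [show (6400 : ℝ) = 2 ^ 8 * 5 ^ 2 by norm_num, log_mul (by norm_num) (by norm_num),
        log_pow, log_pow]
      norm_num
    have h2 := log_two_gt_d9
    have h5 := log_five_gt_d9
    norm_num at h2 h5 ⊢
    linarith
  set L := log N
  obtain ⟨u, hu⟩ : ∃ u, L = 8.76 + u := ⟨L - 8.76, by ring⟩
  have hu0 : 0 ≤ u := by linarith
  rw [hu]
  have := pow_nonneg hu0 2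
  have := pow_nonneg hu0 3
  nlinarith

/-! ### Verification of `∑_{m ≤ n} d(m)² ≤ n (log n)³ / 4` for small `n` -/

/-- The number of divisors of `n` among `1, …, k`, in truncated arithmetic. -/
def smallDivCount (n : ℕ) : ℕ → ℕ
  | 0 => 0
  | k + 1 => smallDivCount n k + (1 - n % (k + 1))

theorem smallDivCount_eq (n k : ℕ) :
    smallDivCount n k = ((Finset.Ioc 0 k).filter (· ∣ n)).card := by
  induction k with
  | zero => rfl
  | succ k ih =>
    rw [smallDivCount, ih, ← Finset.insert_Ioc_right_eq_Ioc_add_one (Nat.zero_le k),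
      Finset.filter_insert]
    split_ifs with h
    · rw [Finset.card_insert_of_notMem (by simp), Nat.mod_eq_zero_of_dvd h]
    · have : n % (k + 1) ≠ 0 := fun h' => h (Nat.dvd_of_mod_eq_zero h')
      omega

theorem numDiv_add_eq {n s : ℕ} (hn : 0 < n) (hs : s * s ≤ n) (hs' : n < (s + 1) * (s + 1)) :
    numDiv n + (1 - (n - s * s)) = 2 * smallDivCount n s := by
  have hlow : ((Finset.Ioc 0 s).filter (· ∣ n)) = n.divisors.filter (· ≤ s) := by
    ext k
    simp only [Finset.mem_filter, Finset.mem_Ioc, Nat.mem_divisors]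
    constructor
    · exact fun h => ⟨⟨h.2, hn.ne'⟩, h.1.2⟩
    · exact fun h => ⟨⟨Nat.pos_of_dvd_of_pos h.1.1 hn, h.2⟩, h.1.1⟩
  have hpt {k : ℕ} (hk : k ∈ n.divisors) :
      (if k ≤ s then 1 else 0) + (if n / k ≤ s then 1 else 0)
        = 1 + if k = s then 1 - (n - s * s) else 0 := by
    obtain ⟨j, rfl⟩ := (Nat.mem_divisors.1 hk).1
    have hk0 : 0 < k := Nat.pos_of_mul_pos_right hn
    rw [Nat.mul_div_cancel_left j hk0]
    rcases lt_trichotomy k s with h | rfl | h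
    · have : ¬ j ≤ s := fun hj => by nlinarith
      simp [h.le, h.ne, this]
    · have hkj : k ≤ j := Nat.le_of_mul_le_mul_left hs hk0
      rcases hkj.eq_or_lt with rfl | hlt
      · simp
      · have : k * k < k * j := Nat.mul_lt_mul_of_pos_left hlt hk0
        simp only [le_refl, if_true, not_le.2 hlt, if_false]
        omega
    · have : j ≤ s := by
        by_contra! hj
        nlinarith
      simp [h.not_ge, h.ne', this]
  have hsum := Finset.sum_congr rfl fun k (hk : k ∈ n.divisors) => hpt hk
  rw [Finset.sum_add_distrib, Nat.sum_div_divisors n fun k => if k ≤ s then 1 else 0,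
    Finset.sum_add_distrib, ← Finset.card_filter, Finset.sum_ite_eq', ← hlow,
    ← smallDivCount_eq, Finset.sum_const, smul_eq_mul, mul_one] at hsum
  have hmem : (if s ∈ n.divisors then 1 - (n - s * s) else 0) = 1 - (n - s * s) := by
    split_ifs with h
    · rfl
    · have : n ≠ s * s := fun h' => h (Nat.mem_divisors.2 ⟨⟨s, h'⟩, hn.ne'⟩)
      omega
  rw [hmem] at hsum
  rw [numDiv, two_mul]
  exact hsum.symm

/-- `f e`, arranged so that the kernel evaluates `e` first. -/
def evalThen (e : ℕ) (f : ℕ → Bool) : Bool := Nat.rec (f 0) (fun m _ => f (m + 1)) e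

theorem evalThen_eq (e : ℕ) (f : ℕ → Bool) : evalThen e f = f e := by
  cases e <;> rfl

/-- Starting from `A = ∑_{m ≤ n} d(m)²` and `s = ⌊√n⌋`, run through `fuel` values of `n`, checking
`4 * 10 ^ 18 * A ≤ n * c` at each of them and that the sum at the end is `T`. -/
def checkRun (c T : ℕ) : ℕ → ℕ → ℕ → ℕ → Bool
  | 0, _, _, A => A == T
  | fuel + 1, n, s, A =>
    Nat.ble (4 * 10 ^ 18 * A) (n * c) &&
      evalThen (n + 1) fun n' =>
        evalThen (s + (1 - (1 - (n' + 1 - (s + 1) * (s + 1))))) fun s' =>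
          evalThen (A + (2 * smallDivCount n' s' - (1 - (n' - s' * s'))) ^ 2) fun A' =>
            checkRun c T fuel n' s' A'

theorem divSqSum_succ (n : ℕ) : divSqSum (n + 1) = divSqSum n + numDiv (n + 1) ^ 2 :=
  Finset.sum_Ioc_succ_top (Nat.zero_le n) _

theorem checkRun_spec {c T fuel n s A : ℕ} (h : checkRun c T fuel n s A = true) (hn : 0 < n)
    (hs : s * s ≤ n) (hs' : n < (s + 1) * (s + 1)) (hA : divSqSum n = A) :
    (∀ m, n ≤ m → m < n + fuel → 4 * 10 ^ 18 * divSqSum m ≤ m * c) ∧ divSqSum (n + fuel) = T := by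
  induction fuel generalizing n s A with
  | zero =>
    rw [checkRun, beq_iff_eq] at h
    exact ⟨fun m h1 h2 => by omega, hA.trans h⟩
  | succ fuel ih =>
    simp only [checkRun, evalThen_eq, Bool.and_eq_true] at h
    obtain ⟨h1, h2⟩ := h
    have h1 := Nat.le_of_ble_eq_true h1
    set s' := s + (1 - (1 - (n + 1 + 1 - (s + 1) * (s + 1)))) with hs'_def
    have hs'1 : s' * s' ≤ n + 1 ∧ n + 1 < (s' + 1) * (s' + 1) := by
      rcases lt_or_ge (n + 1) ((s + 1) * (s + 1)) with h0 | h0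
      · rw [show s' = s by omega]
        omega
      · rw [show s' = s + 1 by omega]
        constructor
        · omega
        · nlinarith
    have hd := numDiv_add_eq (Nat.succ_pos n) hs'1.1 hs'1.2
    have hA' : divSqSum (n + 1)
        = A + (2 * smallDivCount (n + 1) s' - (1 - (n + 1 - s' * s'))) ^ 2 := by
      rw [divSqSum_succ, hA, ← hd, Nat.succ_eq_add_one, Nat.add_sub_cancel]
    obtain ⟨h3, h4⟩ := ih h2 (Nat.succ_pos n) hs'1.1 hs'1.2 hA'
    refine ⟨fun m hm hm' => ?_, by rw [← h4]; congr 1; omega⟩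
    rcases hm.eq_or_lt with rfl | hlt
    · rw [hA]
      exact h1
    · exact h3 m hlt (by omega)

theorem le_log_of_smooth_le {n a b c : ℕ} (h : 2 ^ a * 3 ^ b * 5 ^ c ≤ n) :
    a * 0.6931471803 + b * 1.0986122885 + c * 1.6094379123
      + 2 * ((n : ℝ) - 2 ^ a * 3 ^ b * 5 ^ c) / (n + 2 ^ a * 3 ^ b * 5 ^ c) ≤ log n := by
  set s : ℝ := 2 ^ a * 3 ^ b * 5 ^ c with hs
  have hs0 : 0 < s := by positivity
  have hsn : s ≤ n := by rw [hs]; exact_mod_cast h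
  have hlog : log s = a * log 2 + b * log 3 + c * log 5 := by
    rw [hs, log_mul (by positivity) (by positivity), log_mul (by positivity) (by positivity),
      log_pow, log_pow, log_pow]
  have h1 := le_log_one_add_of_nonneg (x := (n - s) / s)
    (div_nonneg (sub_nonneg.2 hsn) hs0.le)
  have h2 : log n = log s + log (1 + (n - s) / s) := by
    rw [← log_mul hs0.ne' (by positivity [sub_nonneg.2 hsn])]
    congr 1
    field_simp
    ring
  have h3 : 2 * (((n : ℝ) - s) / s) / ((n - s) / s + 2) = 2 * ((n : ℝ) - s) / (n + s) := by
    rw [show ((n : ℝ) - s) / s + 2 = (n + s) / s by field_simp; ring, mul_div_assoc',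
      div_div_div_cancel_right₀ hs0.ne']
  have h4 : (a : ℝ) * 0.6931471803 ≤ a * log 2 := by gcongr; exact log_two_gt_d9.le
  have h5 : (b : ℝ) * 1.0986122885 ≤ b * log 3 := by gcongr; exact log_three_gt_d9.le
  have h6 : (c : ℝ) * 1.6094379123 ≤ c * log 5 := by gcongr; exact log_five_gt_d9.le
  rw [h2, hlog, ← h3]
  linarith

/-- Here `num / 10 ^ 6` is a lower bound for `log n`. -/
theorem divSqSum_le_of_checkRun {num T fuel n s A : ℕ} (a b c : ℕ)
    (h : checkRun (num ^ 3) T fuel n s A = true) (hA : divSqSum n = A)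
    (hn : 0 < n := by norm_num) (hs : s * s ≤ n := by norm_num)
    (hs' : n < (s + 1) * (s + 1) := by norm_num)
    (habc : 2 ^ a * 3 ^ b * 5 ^ c ≤ n := by norm_num)
    (hnum : (num : ℝ) / 10 ^ 6 ≤ a * 0.6931471803 + b * 1.0986122885 + c * 1.6094379123
      + 2 * ((n : ℝ) - 2 ^ a * 3 ^ b * 5 ^ c) / (n + 2 ^ a * 3 ^ b * 5 ^ c) := by norm_num) :
    (∀ m, n ≤ m → m < n + fuel → (divSqSum m : ℝ) ≤ m * log m ^ 3 / 4) ∧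
      divSqSum (n + fuel) = T := by
  obtain ⟨h1, h2⟩ := checkRun_spec h hn hs hs' hA
  refine ⟨fun m hm hm' => ?_, h2⟩
  have hlog : (num : ℝ) / 10 ^ 6 ≤ log m :=
    (hnum.trans (le_log_of_smooth_le habc)).trans
      (log_le_log (Nat.cast_pos.2 hn) (Nat.cast_le.2 hm))
  have h3 : ((4 * 10 ^ 18 * divSqSum m : ℕ) : ℝ) ≤ ((m * num ^ 3 : ℕ) : ℝ) :=
    Nat.cast_le.2 (h1 m hm hm')
  have h4 : (m : ℝ) * ((num : ℝ) / 10 ^ 6) ^ 3 ≤ m * log m ^ 3 := by gcongr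
  push_cast at h3
  rw [div_pow] at h4
  linarith

theorem divSqSum_le_of_small {N : ℕ} (hN : 433 ≤ N) (hN' : N < 6400) :
    (divSqSum N : ℝ) ≤ N * log N ^ 3 / 4 := by
  have e : divSqSum 433 = 24196 :=
    (checkRun_spec (c := 10 ^ 30) (fuel := 432) (n := 1) (s := 1) (A := 1)
      (by decide +kernel) (by norm_num) (by norm_num) (by norm_num) rfl).2
  obtain ⟨b0, e⟩ := divSqSum_le_of_checkRun (num := 6070737) (T := 24700) (fuel := 7) (s := 20)
    4 3 0 (by decide +kernel) e
  obtain ⟨b1, e⟩ := divSqSum_le_of_checkRun (num := 6086774) (T := 25565) (fuel := 10) (s := 20)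
    4 3 0 (by decide +kernel) e
  obtain ⟨b2, e⟩ := divSqSum_le_of_checkRun (num := 6109247) (T := 26457) (fuel := 12) (s := 21)
    1 2 2 (by decide +kernel) e
  obtain ⟨b3, e⟩ := divSqSum_le_of_checkRun (num := 6135563) (T := 28021) (fuel := 18) (s := 21)
    1 2 2 (by decide +kernel) e
  obtain ⟨b4, e⟩ := divSqSum_le_of_checkRun (num := 6173786) (T := 29898) (fuel := 24) (s := 21)
    5 1 1 (by decide +kernel) e
  obtain ⟨b5, e⟩ := divSqSum_le_of_checkRun (num := 6222576) (T := 32839) (fuel := 36) (s := 22)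
    2 0 3 (by decide +kernel) e
  obtain ⟨b6, e⟩ := divSqSum_le_of_checkRun (num := 6291569) (T := 35868) (fuel := 36) (s := 23)
    2 3 1 (by decide +kernel) e
  obtain ⟨b7, e⟩ := divSqSum_le_of_checkRun (num := 6356107) (T := 40573) (fuel := 54) (s := 24)
    6 2 0 (by decide +kernel) e
  obtain ⟨b8, e⟩ := divSqSum_le_of_checkRun (num := 6445719) (T := 48670) (fuel := 90) (s := 25)
    0 0 4 (by decide +kernel) e
  obtain ⟨b9, e⟩ := divSqSum_le_of_checkRun (num := 6579251) (T := 59944) (fuel := 120) (s := 26)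
    4 2 1 (by decide +kernel) e
  obtain ⟨b10, e⟩ := divSqSum_le_of_checkRun (num := 6733397) (T := 80332) (fuel := 210) (s := 28)
    1 4 1 (by decide +kernel) e
  obtain ⟨b11, e⟩ := divSqSum_le_of_checkRun (num := 6956544) (T := 117841) (fuel := 350) (s := 32)
    10 0 0 (by decide +kernel) e
  obtain ⟨b12, e⟩ := divSqSum_le_of_checkRun (num := 7244223) (T := 193917) (fuel := 640) (s := 37)
    1 3 2 (by decide +kernel) e
  obtain ⟨b13, e⟩ := divSqSum_le_of_checkRun (num := 7620705) (T := 284976) (fuel := 700) (s := 45)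
    0 4 2 (by decide +kernel) e
  obtain ⟨b14, e⟩ := divSqSum_le_of_checkRun (num := 7915712) (T := 382890) (fuel := 700) (s := 52)
    2 3 2 (by decide +kernel) e
  obtain ⟨b15, e⟩ := divSqSum_le_of_checkRun (num := 8143226) (T := 486844) (fuel := 700) (s := 58)
    0 3 3 (by decide +kernel) e
  obtain ⟨b16, e⟩ := divSqSum_le_of_checkRun (num := 8328450) (T := 595377) (fuel := 700) (s := 64)
    12 0 0 (by decide +kernel) e
  obtain ⟨b17, e⟩ := divSqSum_le_of_checkRun (num := 8484669) (T := 707154) (fuel := 700) (s := 69)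
    6 1 2 (by decide +kernel) e
  obtain ⟨b18, e⟩ := divSqSum_le_of_checkRun (num := 8619748) (T := 825566) (fuel := 700) (s := 74)
    3 3 2 (by decide +kernel) e
  obtain ⟨b19, e⟩ := divSqSum_le_of_checkRun (num := 8738735) (T := 852264) (fuel := 160) (s := 78)
    11 1 0 (by decide +kernel) e
  rcases lt_or_ge N 440 with h | h
  · exact b0 N (by omega) (by omega)
  rcases lt_or_ge N 450 with h | h
  · exact b1 N (by omega) (by omega)
  rcases lt_or_ge N 462 with h | h
  · exact b2 N (by omega) (by omega)
  rcases lt_or_ge N 480 with h | h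
  · exact b3 N (by omega) (by omega)
  rcases lt_or_ge N 504 with h | h
  · exact b4 N (by omega) (by omega)
  rcases lt_or_ge N 540 with h | h
  · exact b5 N (by omega) (by omega)
  rcases lt_or_ge N 576 with h | h
  · exact b6 N (by omega) (by omega)
  rcases lt_or_ge N 630 with h | h
  · exact b7 N (by omega) (by omega)
  rcases lt_or_ge N 720 with h | h
  · exact b8 N (by omega) (by omega)
  rcases lt_or_ge N 840 with h | h
  · exact b9 N (by omega) (by omega)
  rcases lt_or_ge N 1050 with h | h
  · exact b10 N (by omega) (by omega)
  rcases lt_or_ge N 1400 with h | h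
  · exact b11 N (by omega) (by omega)
  rcases lt_or_ge N 2040 with h | h
  · exact b12 N (by omega) (by omega)
  rcases lt_or_ge N 2740 with h | h
  · exact b13 N (by omega) (by omega)
  rcases lt_or_ge N 3440 with h | h
  · exact b14 N (by omega) (by omega)
  rcases lt_or_ge N 4140 with h | h
  · exact b15 N (by omega) (by omega)
  rcases lt_or_ge N 4840 with h | h
  · exact b16 N (by omega) (by omega)
  rcases lt_or_ge N 5540 with h | h
  · exact b17 N (by omega) (by omega)
  rcases lt_or_ge N 6240 with h | h
  · exact b18 N (by omega) (by omega)
  exact b19 N (by omega) (by omega)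

theorem divSqSum_le {N : ℕ} (hN : 433 ≤ N) : (divSqSum N : ℝ) ≤ N * log N ^ 3 / 4 :=
  (lt_or_ge N 6400).elim (divSqSum_le_of_small hN) divSqSum_le_of_large

/-! ### Partial summation -/

/-- An antiderivative of `-(σ / 2) (log t)³ / t ^ (2σ)`. -/
noncomputable def tailPrimitive (σ t : ℝ) : ℝ :=
  σ / (2 * (2 * σ - 1) ^ 4) * (t ^ (1 - 2 * σ) *
    ((2 * σ - 1) ^ 3 * log t ^ 3 + 3 * (2 * σ - 1) ^ 2 * log t ^ 2 + 6 * (2 * σ - 1) * log t + 6))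

theorem hasDerivAt_tailPrimitive {σ t : ℝ} (hσ : 1 / 2 < σ) (ht : 0 < t) :
    HasDerivAt (tailPrimitive σ) (-(σ / 2) * (t ^ (-(2 * σ)) * log t ^ 3)) t := by
  have hε : 2 * σ - 1 ≠ 0 := by linarith
  have hl := hasDerivAt_log ht.ne'
  have hp := (((((hl.fun_pow 3).const_mul ((2 * σ - 1) ^ 3)).fun_add
    ((hl.fun_pow 2).const_mul (3 * (2 * σ - 1) ^ 2))).fun_add
    (hl.const_mul (6 * (2 * σ - 1)))).fun_add (hasDerivAt_const t (6 : ℝ)))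
  have h := ((hasDerivAt_rpow_const (p := 1 - 2 * σ) (Or.inl ht.ne')).fun_mul hp).const_mul
    (σ / (2 * (2 * σ - 1) ^ 4))
  refine h.congr_deriv ?_
  rw [show (1 - 2 * σ - 1 : ℝ) = -(2 * σ) by ring,
    show (1 - 2 * σ : ℝ) = -(2 * σ) + 1 by ring, rpow_add_one ht.ne']
  generalize t ^ (-(2 * σ)) = y
  obtain ⟨ε, rfl⟩ : ∃ ε, σ = (ε + 1) / 2 := ⟨2 * σ - 1, by ring⟩
  rw [show 2 * ((ε + 1) / 2) - 1 = ε by ring] at hε ⊢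
  push_cast
  field_simp
  ring

theorem tailPrimitive_antitone {σ : ℝ} (hσ : 1 / 2 < σ) :
    AntitoneOn (tailPrimitive σ) (Set.Ici 1) := by
  have hd {t : ℝ} (ht : 1 ≤ t) := hasDerivAt_tailPrimitive hσ (zero_lt_one.trans_le ht)
  refine antitoneOn_of_hasDerivWithinAt_nonpos (convex_Ici 1)
    (fun t ht => (hd ht).continuousAt.continuousWithinAt)
    (fun t ht => (hd (interior_subset ht)).hasDerivWithinAt) fun t ht => ?_
  have ht : 1 ≤ t := interior_subset ht
  have := log_nonneg ht
  have : 0 ≤ σ / 2 * (t ^ (-(2 * σ)) * log t ^ 3) := by positivity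
  linarith

theorem tailPrimitive_sub_step {σ : ℝ} (hσ : 1 / 2 < σ) {n : ℕ} (hn : 433 ≤ n) :
    tailPrimitive σ (n + 1) - divSqSum n * ((n : ℝ) + 1) ^ (-(2 * σ))
      ≤ tailPrimitive σ n - divSqSum n * (n : ℝ) ^ (-(2 * σ)) := by
  have hn1 : (1 : ℝ) ≤ n := by exact_mod_cast (by omega : 1 ≤ n)
  have hd {t : ℝ} (ht : (n : ℝ) ≤ t) :
      HasDerivAt (fun t => tailPrimitive σ t - divSqSum n * t ^ (-(2 * σ)))
        (2 * σ * t ^ (-(2 * σ) - 1) * (divSqSum n - t * log t ^ 3 / 4)) t := by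
    have ht0 : 0 < t := by linarith
    refine ((hasDerivAt_tailPrimitive hσ ht0).fun_sub
      ((hasDerivAt_rpow_const (p := -(2 * σ)) (Or.inl ht0.ne')).const_mul
        (divSqSum n : ℝ))).congr_deriv ?_
    rw [rpow_sub_one ht0.ne']
    field_simp
    ring
  have hanti : AntitoneOn (fun t => tailPrimitive σ t - divSqSum n * t ^ (-(2 * σ)))
      (Set.Ici (n : ℝ)) := by
    refine antitoneOn_of_hasDerivWithinAt_nonpos (convex_Ici _)
      (fun t ht => (hd ht).continuousAt.continuousWithinAt)
      (fun t ht => (hd (interior_subset ht)).hasDerivWithinAt) fun t ht => ?_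
    have ht : (n : ℝ) ≤ t := interior_subset ht
    have ht0 : 0 < t := by linarith
    have h0 := log_nonneg hn1
    have h1 : log n ≤ log t := log_le_log (by linarith) ht
    have h2 : (n : ℝ) * log n ^ 3 ≤ t * log t ^ 3 := by gcongr
    exact mul_nonpos_of_nonneg_of_nonpos (by positivity) (by linarith [divSqSum_le hn])
  exact hanti Set.self_mem_Ici (by simp : (n : ℝ) + 1 ∈ Set.Ici (n : ℝ)) (by simp)

theorem le_tailPrimitive {σ t : ℝ} (hσ : 1 / 2 < σ) (ht : 1 ≤ t) :
    t ^ (-(2 * σ)) * (t * log t ^ 3 / 4) ≤ tailPrimitive σ t := by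
  have ht0 : 0 < t := by linarith
  have hε : 0 < 2 * σ - 1 := by linarith
  have hL := log_nonneg ht
  have h1 : σ / (2 * (2 * σ - 1) ^ 4) * (t ^ (1 - 2 * σ) * ((2 * σ - 1) ^ 3 * log t ^ 3))
      ≤ tailPrimitive σ t := by
    rw [tailPrimitive]
    gcongr
    have : 0 ≤ 3 * (2 * σ - 1) ^ 2 * log t ^ 2 + 6 * (2 * σ - 1) * log t + 6 := by positivity
    linarith
  refine le_trans ?_ h1
  have h2 : (1 : ℝ) / 4 ≤ σ / (2 * (2 * σ - 1)) := by
    rw [div_le_div_iff₀ (by norm_num) (by positivity)]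
    linarith
  have h3 : 0 ≤ t ^ (1 - 2 * σ) * log t ^ 3 := by positivity
  calc t ^ (-(2 * σ)) * (t * log t ^ 3 / 4) = 1 / 4 * (t ^ (1 - 2 * σ) * log t ^ 3) := by
        rw [show (1 - 2 * σ : ℝ) = -(2 * σ) + 1 by ring, rpow_add_one ht0.ne']
        ring
    _ ≤ σ / (2 * (2 * σ - 1)) * (t ^ (1 - 2 * σ) * log t ^ 3) := by gcongr
    _ = _ := by field_simp

theorem sum_add_tailPrimitive_le {σ : ℝ} (hσ : 1 / 2 < σ) {M : ℕ} (hM : 433 ≤ M) {N : ℕ}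
    (hN : M ≤ N) :
    ∑ n ∈ Finset.Icc M N, (numDiv n : ℝ) ^ 2 / (n : ℝ) ^ (2 * σ)
      + (tailPrimitive σ N - divSqSum N * (N : ℝ) ^ (-(2 * σ))) ≤ tailPrimitive σ M := by
  have hdiv (n : ℕ) : (numDiv n : ℝ) ^ 2 / (n : ℝ) ^ (2 * σ)
      = (numDiv n : ℝ) ^ 2 * (n : ℝ) ^ (-(2 * σ)) := by
    rw [rpow_neg n.cast_nonneg, div_eq_mul_inv]
  induction N, hN using Nat.le_induction with
  | base =>
    have h : (numDiv M : ℝ) ^ 2 ≤ divSqSum M := by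
      have : numDiv M ^ 2 ≤ divSqSum M :=
        Finset.single_le_sum (f := fun m => numDiv m ^ 2) (fun _ _ => Nat.zero_le _)
          (Finset.mem_Ioc.2 ⟨by omega, le_rfl⟩)
      exact_mod_cast this
    have := mul_le_mul_of_nonneg_right h (rpow_nonneg M.cast_nonneg (-(2 * σ)))
    rw [Finset.Icc_self, Finset.sum_singleton, hdiv]
    linarith
  | succ N hN ih =>
    have := tailPrimitive_sub_step hσ (hM.trans hN)
    rw [Finset.sum_Icc_succ_top (by omega), hdiv, divSqSum_succ]
    push_cast
    linarith

theorem sum_Icc_le_tailPrimitive {σ : ℝ} (hσ : 1 / 2 < σ) {M : ℕ} (hM : 433 ≤ M) {N : ℕ}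
    (hN : M ≤ N) :
    ∑ n ∈ Finset.Icc M N, (numDiv n : ℝ) ^ 2 / (n : ℝ) ^ (2 * σ) ≤ tailPrimitive σ M := by
  have hN1 : (1 : ℝ) ≤ N := by exact_mod_cast (by omega : 1 ≤ N)
  have h := mul_le_mul_of_nonneg_left (divSqSum_le (hM.trans hN))
    (rpow_nonneg N.cast_nonneg (-(2 * σ)))
  linarith [sum_add_tailPrimitive_le hσ hM hN, le_tailPrimitive hσ hN1]

theorem tsum_le_tailPrimitive {σ X : ℝ} (hσ : 1 / 2 < σ) (hX : 433 ≤ X) :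
    (∑' n : ℕ, if X ≤ (n : ℝ) then (numDiv n : ℝ) ^ 2 / (n : ℝ) ^ (2 * σ) else 0)
      ≤ tailPrimitive σ X := by
  have hM : 433 ≤ ⌈X⌉₊ := by exact_mod_cast hX.trans (Nat.le_ceil X)
  refine Real.tsum_le_of_sum_range_le (fun n => by split_ifs <;> positivity) fun N => ?_
  rw [← Finset.sum_filter]
  calc _ ≤ ∑ n ∈ Finset.Icc ⌈X⌉₊ (max ⌈X⌉₊ N), (numDiv n : ℝ) ^ 2 / (n : ℝ) ^ (2 * σ) := by
        refine Finset.sum_le_sum_of_subset_of_nonneg (fun n hn => ?_) fun n _ _ => by positivity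
        simp only [Finset.mem_filter, Finset.mem_range] at hn
        exact Finset.mem_Icc.2 ⟨Nat.ceil_le.2 hn.2, hn.1.le.trans (le_max_right _ _)⟩
    _ ≤ tailPrimitive σ ⌈X⌉₊ := sum_Icc_le_tailPrimitive hσ hM (le_max_left _ _)
    _ ≤ tailPrimitive σ X := by
        have hX1 : 1 ≤ X := by linarith
        exact tailPrimitive_antitone hσ hX1 (hX1.trans (Nat.le_ceil X)) (Nat.le_ceil X)

theorem tailPrimitive_le {σ X X₀ : ℝ} (hσ : 1 / 2 < σ) (hX₀ : 1 < X₀) (hX : X₀ ≤ X) :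
    tailPrimitive σ X ≤ Cconst σ X₀ * X ^ (1 - 2 * σ) * log X ^ 3 := by
  have hl : 0 < log X₀ := log_pos hX₀
  have hL : log X₀ ≤ log X := log_le_log (by linarith) hX
  have hε : 0 < 2 * σ - 1 := by linarith
  have hX0 : 0 < X := by linarith
  have hr {k : ℕ} : 1 ≤ log X ^ k / log X₀ ^ k :=
    (one_le_div (by positivity)).2 (by gcongr)
  set L := log X
  set l := log X₀
  have hL0 : 0 < L := hl.trans_le hL
  have h1 : L ^ 2 * 1 ≤ L ^ 2 * (L ^ 1 / l ^ 1) := by gcongr; exact hr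
  have h2 : L * 1 ≤ L * (L ^ 2 / l ^ 2) := by gcongr; exact hr
  calc tailPrimitive σ X ≤ σ / (2 * (2 * σ - 1) ^ 4) * (X ^ (1 - 2 * σ) *
        ((2 * σ - 1) ^ 3 * L ^ 3 + 3 * (2 * σ - 1) ^ 2 * (L ^ 2 * (L ^ 1 / l ^ 1))
          + 6 * (2 * σ - 1) * (L * (L ^ 2 / l ^ 2)) + 6 * (L ^ 3 / l ^ 3))) := by
        rw [tailPrimitive]
        gcongr
        · linarith
        · linarith
        · linarith [hr (k := 3)]
    _ = _ := by rw [Cconst]; ring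

/-- For `0.6 ≤ σ ≤ 2/3` and `X ≥ X₀ ≥ 433`,
`Σ_{n ≥ X} d(n)²/n^{2σ} ≤ C(σ,X₀) · X^{1−2σ} · (log X)³`. -/
theorem divisor_sq_tail_sum_sigma (σ X X₀ : ℝ) (hσl : 0.6 ≤ σ) (hσu : σ ≤ 2/3)
    (hX₀ : 433 ≤ X₀) (hX : X₀ ≤ X) :
    (∑' n : ℕ, if X ≤ (n : ℝ) then (numDiv n : ℝ)^2 / (n : ℝ)^(2*σ) else 0)
      ≤ Cconst σ X₀ * X^(1 - 2*σ) * (Real.log X)^3 := by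
  have hσ : 1 / 2 < σ := by norm_num at hσl; linarith
  exact (tsum_le_tailPrimitive hσ (hX₀.trans hX)).trans
    (tailPrimitive_le hσ (by linarith) hX)
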